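/- arXiv:1906.11965 — 2 statements merged into one kernel-verified Lean document; each statement's English description precedes it below -/
import Mathlib

section
/- For a regular tetrahedron with unit edge, the intrinsic diameter is Diam(T) = 2/√3; moreover it is realized between a vertex and the centroid of its opposite face: ρ(a, (b + c + d)/3) = 2/√3. -/
open scoped ENNReal

/-- The intrinsic (geodesic) distance on a subset `T` of `ℝ³`: the infimum of the lengths of
continuous paths from `x` to `y` staying in `T`. -/
noncomputable def rho (T : Set (EuclideanSpace ℝ (Fin 3)))
    (x y : EuclideanSpace ℝ (Fin 3)) : ℝ≥0∞ :=
  ⨅ (γ : ℝ → EuclideanSpace ℝ (Fin 3)) (_ : Continuous γ) (_ : γ 0 = x) (_ : γ 1 = y)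
    (_ : ∀ t ∈ Set.Icc (0 : ℝ) 1, γ t ∈ T), eVariationOn γ (Set.Icc 0 1)

/-- Intrinsic diameter. -/
noncomputable def intrinsicDiam (T : Set (EuclideanSpace ℝ (Fin 3))) : ℝ≥0∞ :=
  ⨆ x ∈ T, ⨆ y ∈ T, rho T x y

/-- Intrinsic radius. -/
noncomputable def intrinsicRad (T : Set (EuclideanSpace ℝ (Fin 3))) : ℝ≥0∞ :=
  ⨅ x ∈ T, ⨆ y ∈ T, rho T x y

/-- Extrinsic radius. -/
noncomputable def extrinsicRad (T : Set (EuclideanSpace ℝ (Fin 3))) : ℝ≥0∞ :=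
  ⨅ x ∈ T, ⨆ y ∈ T, edist x y

section Equilateral

variable {ι V : Type*} [Fintype ι] [NormedAddCommGroup V] [InnerProductSpace ℝ V]

theorem norm_sq_weightedVSub_of_pairwise_dist_eq_one {P : ι → V}
    (hP : Pairwise fun i j => dist (P i) (P j) = 1) {w : ι → ℝ} (hw : ∑ i, w i = 0) :
    ‖Finset.univ.weightedVSub P w‖ ^ 2 = (∑ i, w i ^ 2) / 2 := by
  classical
  rw [← real_inner_self_eq_norm_sq, EuclideanGeometry.inner_weightedVSub P hw P hw]
  have h : ∀ i j, w i * w j * (dist (P i) (P j) * dist (P i) (P j)) =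
      w i * w j - if i = j then w i * w j else 0 := by
    intro i j
    by_cases hij : i = j
    · simp [hij]
    · simp [hij, hP hij]
  simp only [h, Finset.sum_sub_distrib, ← Finset.mul_sum, hw, mul_zero,
    Finset.sum_ite_eq, Finset.mem_univ, if_true, zero_sub, Finset.sum_neg_distrib, neg_neg, sq]

theorem affineIndependent_of_pairwise_dist_eq_one {P : ι → V}
    (hP : Pairwise fun i j => dist (P i) (P j) = 1) : AffineIndependent ℝ P := by
  rw [affineIndependent_iff_of_fintype]
  intro w hw h i
  have h2 := norm_sq_weightedVSub_of_pairwise_dist_eq_one hP hw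
  rw [h, norm_zero] at h2
  have h3 : ∑ i, w i ^ 2 = 0 := by linarith
  rw [Finset.sum_eq_zero_iff_of_nonneg fun i _ => sq_nonneg _] at h3
  exact pow_eq_zero_iff two_ne_zero |>.1 (h3 i (Finset.mem_univ i))

namespace AffineBasis

theorem dist_sq_of_pairwise_dist_eq_one (P : AffineBasis ι ℝ V)
    (hP : Pairwise fun i j => dist (P i) (P j) = 1) (x y : V) :
    dist x y ^ 2 = (∑ i, (P.coord i x - P.coord i y) ^ 2) / 2 := by
  have hw : ∑ i, (P.coord i x - P.coord i y) = 0 := by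
    rw [Finset.sum_sub_distrib, P.sum_coord_apply_eq_one, P.sum_coord_apply_eq_one, sub_self]
  rw [← norm_sq_weightedVSub_of_pairwise_dist_eq_one hP hw,
    Finset.weightedVSub_eq_linear_combination _ hw]
  simp only [sub_smul, Finset.sum_sub_distrib, P.linear_combination_coord_eq_self, dist_eq_norm]

end AffineBasis

end Equilateral

theorem AffineBasis.mem_frontier_convexHull_iff {ι V : Type*} [Finite ι] [NormedAddCommGroup V]
    [NormedSpace ℝ V] (P : AffineBasis ι ℝ V) {x : V} :
    x ∈ frontier (convexHull ℝ (Set.range P)) ↔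
      (∀ i, 0 ≤ P.coord i x) ∧ ∃ i, P.coord i x = 0 := by
  rw [((Set.finite_range P).isClosed_convexHull ℝ).frontier_eq, P.interior_convexHull,
    P.convexHull_eq_nonneg_coord]
  simp only [Set.mem_sdiff, Set.mem_ofPred_eq, not_forall, not_lt]
  exact and_congr_right fun h => exists_congr fun i => ⟨fun hi => hi.antisymm (h i), Eq.le⟩

section FoldingMap

theorem AddCircle.coe_sub_int_mul (r : ℝ) (k : ℤ) (T : ℝ) :
    ((r - k * T : ℝ) : AddCircle T) = r := by
  rw [AddCircle.coe_sub, sub_eq_self, AddCircle.coe_eq_zero_iff]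
  exact ⟨k, zsmul_eq_mul T k⟩

theorem AddCircle.norm_coe_two_eq_abs {s : ℝ} (hs : |s| ≤ 1) : ‖(s : AddCircle (2 : ℝ))‖ = |s| :=
  (AddCircle.norm_coe_eq_abs_iff 2 two_ne_zero).2 (by simpa using hs)

theorem AddCircle.exists_coe_two_eq (p : ℝ) :
    ∃ x : ℝ, |x| ≤ 1 ∧ (p : AddCircle (2 : ℝ)) = x := by
  have hx : |p - round (p / 2) * 2| ≤ 1 := by
    have := abs_sub_round (p / 2)
    rw [abs_le] at this ⊢
    constructor <;> linarith
  have hp := (AddCircle.coe_sub_int_mul p (round (p / 2)) 2).symm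
  exact ⟨_, hx, hp⟩

theorem AddCircle.norm_coe_two_eq_two_sub_abs {s : ℝ} (h1 : 1 ≤ |s|) (h2 : |s| ≤ 2) :
    ‖(s : AddCircle (2 : ℝ))‖ = 2 - |s| := by
  wlog hs : 0 ≤ s generalizing s
  · have := this (s := -s) (by rwa [abs_neg]) (by rwa [abs_neg]) (by linarith)
    rwa [abs_neg, AddCircle.coe_neg, norm_neg] at this
  rw [abs_of_nonneg hs] at *
  have hp : (s : AddCircle (2 : ℝ)) = ((s - 2 : ℝ) : AddCircle (2 : ℝ)) := by
    rw [AddCircle.coe_sub, AddCircle.coe_period, sub_zero]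
  have hle : |s - 2| ≤ 1 := by rw [abs_le]; constructor <;> linarith
  rw [hp, AddCircle.norm_coe_two_eq_abs hle, abs_of_nonpos (by linarith)]
  ring

/-- Barycentric coordinates of the image of the point `(p, q)` of the triangular lattice plane
under the folding of that plane onto the surface of the tetrahedron. -/
noncomputable def foldWeights (p q : ℝ) : Fin 4 → ℝ :=
  let X := ‖(p : AddCircle (2 : ℝ))‖
  let Y := ‖(q : AddCircle (2 : ℝ))‖
  let Z := ‖((p + q : ℝ) : AddCircle (2 : ℝ))‖
  ![1 - (X + Y + Z) / 2, (X + Z - Y) / 2, (Y + Z - X) / 2, (X + Y - Z) / 2]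

theorem sum_foldWeights (p q : ℝ) : ∑ i, foldWeights p q i = 1 := by
  simp [foldWeights, Fin.sum_univ_four]
  ring

theorem foldWeights_eq_of_coe_eq {p p' q q' : ℝ} (hp : (p : AddCircle (2 : ℝ)) = p')
    (hq : (q : AddCircle (2 : ℝ)) = q') : foldWeights p q = foldWeights p' q' := by
  simp only [foldWeights, AddCircle.coe_add, hp, hq]

theorem foldWeights_neg (p q : ℝ) : foldWeights (-p) (-q) = foldWeights p q := by
  simp only [foldWeights, ← neg_add, AddCircle.coe_neg, norm_neg]

theorem foldWeights_nonneg_and_exists_eq_zero (p q : ℝ) :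
    (∀ i, 0 ≤ foldWeights p q i) ∧ ∃ i, foldWeights p q i = 0 := by
  obtain ⟨x, hx, hpx⟩ := AddCircle.exists_coe_two_eq p
  obtain ⟨y, hy, hqy⟩ := AddCircle.exists_coe_two_eq q
  rw [foldWeights_eq_of_coe_eq hpx hqy]
  clear hpx hqy
  wlog h0 : 0 ≤ x generalizing x y
  · have := this (-x) (by rwa [abs_neg]) (-y) (by rwa [abs_neg]) (by linarith)
    rwa [foldWeights_neg] at this
  have hx1 := (abs_le.1 hx).2
  have hy1 := abs_le.1 hy
  simp only [foldWeights, AddCircle.norm_coe_two_eq_abs hx, AddCircle.norm_coe_two_eq_abs hy,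
    abs_of_nonneg h0, Fin.forall_fin_succ, Fin.exists_fin_succ, Matrix.cons_val_zero,
    Matrix.cons_val_succ, IsEmpty.forall_iff, IsEmpty.exists_iff, and_true, or_false]
  rcases le_total 0 y with hy0 | hy0
  · rw [abs_of_nonneg hy0]
    have hxy : |x + y| = x + y := abs_of_nonneg (by linarith)
    rcases le_total (x + y) 1 with h | h
    · rw [AddCircle.norm_coe_two_eq_abs (by rwa [hxy]), hxy]
      exact ⟨⟨by linarith, by linarith, by linarith, by linarith⟩, by right; right; right; ring⟩
    · rw [AddCircle.norm_coe_two_eq_two_sub_abs (by rwa [hxy]) (by rw [hxy]; linarith), hxy]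
      exact ⟨⟨by linarith, by linarith, by linarith, by linarith⟩, by left; ring⟩
  · rw [abs_of_nonpos hy0,
      AddCircle.norm_coe_two_eq_abs (abs_le.2 ⟨by linarith, by linarith⟩)]
    rcases abs_cases (x + y) with ⟨h, h'⟩ | ⟨h, h'⟩ <;> rw [h]
    · exact ⟨⟨by linarith, by linarith, by linarith, by linarith⟩, by right; right; left; ring⟩
    · exact ⟨⟨by linarith, by linarith, by linarith, by linarith⟩, by right; left; ring⟩

theorem exists_foldWeights_eq {w : Fin 4 → ℝ} (h1 : ∑ i, w i = 1) (h0 : ∀ i, 0 ≤ w i)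
    (hz : ∃ i, w i = 0) : ∃ p q, foldWeights p q = w := by
  rw [Fin.sum_univ_four] at h1
  have ha := h0 0
  have hb := h0 1
  have hc := h0 2
  have hd := h0 3
  have hX : ‖((w 1 + w 3 : ℝ) : AddCircle (2 : ℝ))‖ = w 1 + w 3 := by
    rw [AddCircle.norm_coe_two_eq_abs] <;> rw [abs_of_nonneg] <;> linarith
  have hY : ‖((w 2 + w 3 : ℝ) : AddCircle (2 : ℝ))‖ = w 2 + w 3 := by
    rw [AddCircle.norm_coe_two_eq_abs] <;> rw [abs_of_nonneg] <;> linarith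
  have hplus : ‖((w 1 + w 3 + (w 2 + w 3) : ℝ) : AddCircle (2 : ℝ))‖ = w 1 + w 2 →
      foldWeights (w 1 + w 3) (w 2 + w 3) = w := by
    intro h
    funext i
    simp only [foldWeights, hX, hY, h]
    fin_cases i <;> simp <;> linarith
  have hminus : |w 1 - w 2| = w 1 + w 2 →
      foldWeights (w 1 + w 3) (-(w 2 + w 3)) = w := by
    intro h
    have hZ : ‖((w 1 + w 3 + -(w 2 + w 3) : ℝ) : AddCircle (2 : ℝ))‖ = w 1 + w 2 := by
      rw [← sub_eq_add_neg, add_sub_add_right_eq_sub, AddCircle.norm_coe_two_eq_abs, h]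
      rw [h]
      linarith
    funext i
    simp only [foldWeights, AddCircle.coe_neg, norm_neg, hX, hY, hZ]
    fin_cases i <;> simp <;> linarith
  have hs : |w 1 + w 3 + (w 2 + w 3)| = w 1 + w 3 + (w 2 + w 3) := abs_of_nonneg (by linarith)
  obtain ⟨i, hi⟩ := hz
  fin_cases i <;> simp only [Fin.zero_eta, Fin.mk_one, Fin.reduceFinMk] at hi
  · refine ⟨_, _, hplus ?_⟩
    rw [AddCircle.norm_coe_two_eq_two_sub_abs] <;> rw [hs] <;> linarith
  · exact ⟨_, _, hminus (by rw [hi, zero_sub, zero_add, abs_neg, abs_of_nonneg hc])⟩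
  · exact ⟨_, _, hminus (by rw [hi, sub_zero, add_zero, abs_of_nonneg hb])⟩
  · refine ⟨_, _, hplus ?_⟩
    rw [AddCircle.norm_coe_two_eq_abs] <;> rw [hs] <;> linarith

theorem abs_norm_coe_addCircle_sub_le (T p p' : ℝ) :
    |‖(p : AddCircle T)‖ - ‖(p' : AddCircle T)‖| ≤ |p - p'| :=
  (abs_norm_sub_norm_le _ _).trans (by
    rw [← AddCircle.coe_sub, ← Real.norm_eq_abs]
    exact QuotientAddGroup.norm_mk_le_norm)

theorem sum_foldWeights_sub_sq_le (p q p' q' : ℝ) :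
    (∑ i, (foldWeights p q i - foldWeights p' q' i) ^ 2) / 2 ≤
      (p - p') ^ 2 + (p - p') * (q - q') + (q - q') ^ 2 := by
  have hX := sq_le_sq.2 (abs_norm_coe_addCircle_sub_le 2 p p')
  have hY := sq_le_sq.2 (abs_norm_coe_addCircle_sub_le 2 q q')
  have hZ := sq_le_sq.2 (abs_norm_coe_addCircle_sub_le 2 (p + q) (p' + q'))
  simp only [foldWeights, Fin.sum_univ_four, Matrix.cons_val]
  nlinarith

end FoldingMap

theorem exists_int_triangular_form_sub_le (x y : ℝ) :
    ∃ m n : ℤ, (x - m) ^ 2 + (x - m) * (y - n) + (y - n) ^ 2 ≤ 1 / 3 := by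
  have key : ∀ u v : ℝ, 0 ≤ u → 0 ≤ v → u + v ≤ 1 →
      ∃ m n : ℤ, (u - m) ^ 2 + (u - m) * (v - n) + (v - n) ^ 2 ≤ 1 / 3 := by
    intro u v hu hv huv
    by_contra! h
    have h1 := h 0 0
    have h2 := h 1 0
    have h3 := h 0 1
    push_cast at h1 h2 h3
    have e1 := mul_nonneg (sub_nonneg.2 huv) (sub_nonneg.2 h1.le)
    have e2 := mul_nonneg hu (sub_nonneg.2 h2.le)
    have e3 := mul_nonneg hv (sub_nonneg.2 h3.le)
    have hu3 : u = 1 / 3 := by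
      nlinarith [sq_nonneg (u - v), sq_nonneg (u + v - 2 / 3)]
    have hv3 : v = 1 / 3 := by
      nlinarith [sq_nonneg (u - v), sq_nonneg (u + v - 2 / 3)]
    norm_num [hu3, hv3] at h1
  rcases le_total (Int.fract x + Int.fract y) 1 with h | h
  · obtain ⟨m, n, hmn⟩ := key _ _ (Int.fract_nonneg x) (Int.fract_nonneg y) h
    refine ⟨⌊x⌋ + m, ⌊y⌋ + n, ?_⟩
    push_cast
    convert hmn using 1
    rw [← sub_sub, ← sub_sub, Int.self_sub_floor, Int.self_sub_floor]
  · obtain ⟨m, n, hmn⟩ := key (1 - Int.fract x) (1 - Int.fract y)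
      (by linarith [Int.fract_lt_one x]) (by linarith [Int.fract_lt_one y]) (by linarith)
    refine ⟨⌊x⌋ + 1 - m, ⌊y⌋ + 1 - n, ?_⟩
    push_cast
    rw [Int.fract, Int.fract] at hmn
    nlinarith

section Rho

variable {T : Set (EuclideanSpace ℝ (Fin 3))} {x y : EuclideanSpace ℝ (Fin 3)}

theorem rho_le_of_dist_le {γ : ℝ → EuclideanSpace ℝ (Fin 3)} {L : ℝ} (hL : 0 ≤ L)
    (h : ∀ s t, dist (γ s) (γ t) ≤ L * |s - t|) (h0 : γ 0 = x) (h1 : γ 1 = y)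
    (hT : ∀ t, γ t ∈ T) : rho T x y ≤ ENNReal.ofReal L := by
  have hγ : LipschitzWith ⟨L, hL⟩ γ := LipschitzWith.of_dist_le_mul h
  refine (iInf₂_le γ hγ.continuous).trans <| (iInf₂_le h0 h1).trans <|
    (iInf_le _ fun t _ => hT t).trans ?_
  have hlen := hγ.lipschitzOnWith (s := Set.univ) |>.comp_eVariationOn_le
    (g := id) (s := Set.Icc (0 : ℝ) 1) (Set.mapsTo_univ _ _)
  have hid : eVariationOn (id : ℝ → ℝ) (Set.Icc 0 1) ≤ 1 := by
    simpa only [Set.inter_self, id_eq, sub_zero, ENNReal.ofReal_one] using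
      ((monotoneOn_id (s := Set.Icc (0 : ℝ) 1)).eVariationOn_eq (a := 0) (b := 1)
        (by simp) (by simp)).le
  rw [Function.comp_id] at hlen
  refine hlen.trans ((mul_le_mul_right hid _).trans ?_)
  rw [mul_one, ENNReal.ofReal_eq_coe_nnreal hL]
  exact le_rfl

theorem le_rho_of_exists_mem {L : ℝ≥0∞}
    (h : ∀ γ : ℝ → EuclideanSpace ℝ (Fin 3), Continuous γ → γ 0 = x → γ 1 = y →
      (∀ t ∈ Set.Icc (0 : ℝ) 1, γ t ∈ T) →
        ∃ t ∈ Set.Icc (0 : ℝ) 1, L ≤ edist x (γ t) + edist (γ t) y) : L ≤ rho T x y := by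
  refine le_iInf₂ fun γ hγ => le_iInf₂ fun h0 h1 => le_iInf fun hT => ?_
  obtain ⟨t, ht, hL⟩ := h γ hγ h0 h1 hT
  rw [← h0, ← h1] at hL
  have hsplit := eVariationOn.Icc_add_Icc γ ht.1 ht.2 ht
  simp only [Set.inter_self, Set.inter_eq_right.2 (Set.Icc_subset_Icc_right ht.2),
    Set.inter_eq_right.2 (Set.Icc_subset_Icc_left ht.1)] at hsplit
  rw [← hsplit]
  exact hL.trans (add_le_add
    (eVariationOn.edist_le γ (Set.left_mem_Icc.2 ht.1) (Set.right_mem_Icc.2 ht.1))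
    (eVariationOn.edist_le γ (Set.left_mem_Icc.2 ht.2) (Set.right_mem_Icc.2 ht.2)))

end Rho

theorem exists_eq_zero_and_eq_zero_of_exists_eq_zero {f : ℝ → ℝ} {g : ℝ → ℝ}
    (hf : Continuous f) (hg : Continuous g) (h0 : f 0 ≠ 0) (h1 : f 1 = 0)
    (h : ∀ t ∈ Set.Icc (0 : ℝ) 1, f t = 0 ∨ g t = 0) :
    ∃ t ∈ Set.Icc (0 : ℝ) 1, f t = 0 ∧ g t = 0 := by
  obtain ⟨t, ⟨htI, ht⟩, hmin⟩ := (isCompact_Icc.inter_right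
    (isClosed_singleton.preimage hf) : IsCompact (Set.Icc (0 : ℝ) 1 ∩ f ⁻¹' {0})).exists_isLeast
      ⟨1, by simp, h1⟩
  refine ⟨t, htI, ht, ?_⟩
  have ht0 : (0 : ℝ) ≠ t := fun h => h0 (h ▸ ht)
  have hEq : Set.EqOn g 0 (Set.Ico 0 t) := fun s hs =>
    (h s ⟨hs.1, hs.2.le.trans htI.2⟩).resolve_left fun hfs =>
      hs.2.not_ge (hmin ⟨⟨hs.1, hs.2.le.trans htI.2⟩, hfs⟩)
  have hcl := hEq.closure hg continuous_const
  rw [closure_Ico ht0] at hcl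
  exact hcl (Set.right_mem_Icc.2 htI.1)

section Tetrahedron

variable (P : AffineBasis (Fin 4) ℝ (EuclideanSpace ℝ (Fin 3)))

theorem rho_frontier_tetrahedron_le (hP : Pairwise fun i j => dist (P i) (P j) = 1)
    {x y : EuclideanSpace ℝ (Fin 3)} (hx : x ∈ frontier (convexHull ℝ (Set.range P)))
    (hy : y ∈ frontier (convexHull ℝ (Set.range P))) :
    rho (frontier (convexHull ℝ (Set.range P))) x y ≤ ENNReal.ofReal (2 / Real.sqrt 3) := by
  let F : ℝ → ℝ → EuclideanSpace ℝ (Fin 3) := fun p q =>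
    Finset.univ.affineCombination ℝ P (foldWeights p q)
  have hF : ∀ p q i, P.coord i (F p q) = foldWeights p q i := fun p q i =>
    P.coord_apply_combination_of_mem (Finset.mem_univ i) (sum_foldWeights p q)
  have hsurj : ∀ {z}, z ∈ frontier (convexHull ℝ (Set.range P)) → ∃ p q, F p q = z := by
    intro z hz
    obtain ⟨h0, hz⟩ := P.mem_frontier_convexHull_iff.1 hz
    obtain ⟨p, q, h⟩ := exists_foldWeights_eq (P.sum_coord_apply_eq_one z) h0 hz
    exact ⟨p, q, P.ext_elem fun i => by rw [hF, h]⟩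
  obtain ⟨p, q, rfl⟩ := hsurj hx
  obtain ⟨p', q', rfl⟩ := hsurj hy
  obtain ⟨m, n, hmn⟩ := exists_int_triangular_form_sub_le ((p' - p) / 2) ((q' - q) / 2)
  have hend : F (p' - m * 2) (q' - n * 2) = F p' q' := by
    simp only [F, foldWeights_eq_of_coe_eq (AddCircle.coe_sub_int_mul p' m 2)
      (AddCircle.coe_sub_int_mul q' n 2)]
  refine rho_le_of_dist_le
    (γ := fun t => F (p + t * (p' - m * 2 - p)) (q + t * (q' - n * 2 - q)))
    (by positivity) (fun s t => ?_) (by simp) (by simpa using hend)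
    fun t => P.mem_frontier_convexHull_iff.2 ?_
  · refine abs_le_of_sq_le_sq' ?_ (by positivity) |>.2
    rw [P.dist_sq_of_pairwise_dist_eq_one hP]
    simp only [hF]
    refine (sum_foldWeights_sub_sq_le _ _ _ _).trans ?_
    rw [mul_pow, div_pow, Real.sq_sqrt zero_le_three, sq_abs]
    have := mul_le_mul_of_nonneg_right hmn (sq_nonneg (s - t))
    linarith
  · simpa only [hF] using foldWeights_nonneg_and_exists_eq_zero _ _

theorem le_rho_vertex_centroid (hP : Pairwise fun i j => dist (P i) (P j) = 1)
    {g : EuclideanSpace ℝ (Fin 3)} (hg0 : P.coord 0 g = 0)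
    (hg : ∀ i : Fin 3, P.coord i.succ g = 1 / 3) :
    ENNReal.ofReal (2 / Real.sqrt 3) ≤
      rho (frontier (convexHull ℝ (Set.range P))) (P 0) g := by
  refine le_rho_of_exists_mem fun γ hγ h0 h1 hT => ?_
  have hc := fun i => (continuous_barycentric_coord P i).comp hγ
  obtain ⟨t, ht, hf, hprod⟩ := exists_eq_zero_and_eq_zero_of_exists_eq_zero (hc 0)
    (continuous_finsetProd Finset.univ fun i _ => hc (Fin.succ i))
    (by simp [h0]) (by simp [h1, hg0])
    (fun t ht => by
      obtain ⟨i, hi⟩ := (P.mem_frontier_convexHull_iff.1 (hT t ht)).2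
      refine i.cases (motive := fun i => P.coord i (γ t) = 0 → _) Or.inl
        (fun i hi => Or.inr ?_) hi
      exact Finset.prod_eq_zero (Finset.mem_univ i) hi)
  refine ⟨t, ht, ?_⟩
  have hsum := P.sum_coord_apply_eq_one (γ t)
  have hd1 := P.dist_sq_of_pairwise_dist_eq_one hP (P 0) (γ t)
  have hd2 := P.dist_sq_of_pairwise_dist_eq_one hP (γ t) g
  simp only [Function.comp_apply, Fin.prod_univ_three, mul_eq_zero] at hf hprod
  simp only [Fin.sum_univ_succ (n := 3), Fin.sum_univ_three, hg, hg0, hf, P.coord_apply,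
    Fin.succ_ne_zero, if_true, if_false] at hsum hd1 hd2
  have hhalf : 1 / 2 ≤ P.coord (Fin.succ 0) (γ t) ^ 2 + P.coord (Fin.succ 1) (γ t) ^ 2 +
      P.coord (Fin.succ 2) (γ t) ^ 2 := by
    have hi := fun i : Fin 3 => sq_nonneg (P.coord i.succ (γ t) - 1 / 2)
    have hi0 := hi 0
    have hi1 := hi 1
    have hi2 := hi 2
    rcases hprod with (h | h) | h <;> rw [h] at hsum ⊢ <;> linarith
  have hs3 : 0 < Real.sqrt 3 := by positivity
  have hsq : Real.sqrt 3 ^ 2 = 3 := Real.sq_sqrt zero_le_three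
  have hle1 : Real.sqrt 3 / 2 ≤ dist (P 0) (γ t) := by
    refine abs_le_of_sq_le_sq' ?_ dist_nonneg |>.2
    rw [hd1, div_pow, hsq]
    linarith
  have hle2 : Real.sqrt 3 / 6 ≤ dist (γ t) g := by
    refine abs_le_of_sq_le_sq' ?_ dist_nonneg |>.2
    rw [hd2, div_pow, hsq]
    linarith
  rw [edist_dist, edist_dist, ← ENNReal.ofReal_add dist_nonneg dist_nonneg]
  refine ENNReal.ofReal_le_ofReal ?_
  have : 2 / Real.sqrt 3 = Real.sqrt 3 / 2 + Real.sqrt 3 / 6 := by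
    field_simp
    linarith
  linarith

end Tetrahedron

theorem stmt13 (a b c d : EuclideanSpace ℝ (Fin 3))
    (h1 : dist a b = 1) (h2 : dist a c = 1) (h3 : dist a d = 1)
    (h4 : dist b c = 1) (h5 : dist b d = 1) (h6 : dist c d = 1)
    (T : Set (EuclideanSpace ℝ (Fin 3)))
    (hT : T = frontier (convexHull ℝ ({a, b, c, d} : Set (EuclideanSpace ℝ (Fin 3))))) :
    intrinsicDiam T = ENNReal.ofReal (2 / Real.sqrt 3) ∧
      rho T a ((3 : ℝ)⁻¹ • (b + c + d)) = ENNReal.ofReal (2 / Real.sqrt 3) := by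
  have hP : Pairwise fun i j => dist (![a, b, c, d] i) (![a, b, c, d] j) = 1 := by
    intro i j hij
    fin_cases i <;> fin_cases j <;> first | exact absurd rfl hij | simpa [dist_comm]
  have hind := affineIndependent_of_pairwise_dist_eq_one hP
  let P : AffineBasis (Fin 4) ℝ (EuclideanSpace ℝ (Fin 3)) :=
    ⟨![a, b, c, d], hind, hind.affineSpan_eq_top_iff_card_eq_finrank_add_one.2 (by simp)⟩
  have hTP : T = frontier (convexHull ℝ (Set.range P)) := by
    rw [hT]
    congr 2
    change _ = Set.range ![a, b, c, d]
    simp only [Matrix.range_cons, Matrix.range_empty, Set.union_empty, Set.singleton_union]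
  have hwg : ∑ i, (![0, 1 / 3, 1 / 3, 1 / 3] : Fin 4 → ℝ) i = 1 := by
    simp only [Fin.sum_univ_four, Matrix.cons_val]
    norm_num
  have hg : (3 : ℝ)⁻¹ • (b + c + d) =
      Finset.univ.affineCombination ℝ P ![0, 1 / 3, 1 / 3, 1 / 3] := by
    rw [Finset.affineCombination_eq_linear_combination _ _ _ hwg]
    change _ = ∑ i, (![0, 1 / 3, 1 / 3, 1 / 3] : Fin 4 → ℝ) i • ![a, b, c, d] i
    simp [Fin.sum_univ_four]
  have hcoord := fun i => P.coord_apply_combination_of_mem (Finset.mem_univ i) hwg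
  rw [← hg] at hcoord
  have hcg0 := hcoord 0
  have hcg : ∀ i : Fin 3, P.coord i.succ ((3 : ℝ)⁻¹ • (b + c + d)) = 1 / 3 := fun i => by
    rw [hcoord]
    fin_cases i <;> rfl
  have hgT : (3 : ℝ)⁻¹ • (b + c + d) ∈ T := by
    rw [hTP, P.mem_frontier_convexHull_iff, Fin.forall_fin_succ]
    exact ⟨⟨hcg0.ge, fun i => by rw [hcg]; norm_num⟩, 0, hcg0⟩
  have haT : a ∈ T := by
    rw [hTP, P.mem_frontier_convexHull_iff]
    change (∀ i, 0 ≤ P.coord i (P 0)) ∧ ∃ i, P.coord i (P 0) = 0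
    simp only [P.coord_apply]
    exact ⟨fun i => by split_ifs <;> norm_num, 1, by simp⟩
  have hub : ∀ x ∈ T, ∀ y ∈ T, rho T x y ≤ ENNReal.ofReal (2 / Real.sqrt 3) := by
    rw [hTP]
    exact fun x hx y hy => rho_frontier_tetrahedron_le P hP hx hy
  have hlb : ENNReal.ofReal (2 / Real.sqrt 3) ≤ rho T a ((3 : ℝ)⁻¹ • (b + c + d)) := by
    rw [hTP]
    exact le_rho_vertex_centroid P hP hcg0 hcg
  refine ⟨le_antisymm (iSup₂_le fun x hx => iSup₂_le fun y hy => hub x hx y hy) ?_,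
    le_antisymm (hub _ haT _ hgT) hlb⟩
  exact hlb.trans ((le_iSup₂ (f := fun y _ => rho T a y) _ hgT).trans
    (le_iSup₂ (f := fun x _ => ⨆ y ∈ T, rho T x y) a haT))
end

section
/- There exists ε₀ > 0 such that every ε₀-thick tetrahedron satisfies Diam(T) = diam(T). -/
open scoped ENNReal

local notation "E3" => EuclideanSpace ℝ (Fin 3)

theorem edist_le_rho (T : Set E3) (x y : E3) : edist x y ≤ rho T x y := by
  unfold rho
  refine le_iInf fun γ => le_iInf fun _ => le_iInf fun h0 => le_iInf fun h1 => le_iInf fun _ => ?_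
  rw [← h0, ← h1]
  exact eVariationOn.edist_le _ (by simp) (by simp)

theorem rho_le_of_path {T : Set E3} {x y : E3} {γ : ℝ → E3} (hγ : Continuous γ) (h0 : γ 0 = x)
    (h1 : γ 1 = y) (hT : ∀ t ∈ Set.Icc (0 : ℝ) 1, γ t ∈ T) :
    rho T x y ≤ eVariationOn γ (Set.Icc 0 1) := by
  unfold rho
  exact iInf_le_of_le γ <| iInf_le_of_le hγ <| iInf_le_of_le h0 <| iInf_le_of_le h1 <|
    iInf_le_of_le hT le_rfl

theorem rho_le_edist_of_segment {T : Set E3} {x y : E3}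
    (h : ∀ t ∈ Set.Icc (0 : ℝ) 1, AffineMap.lineMap x y t ∈ T) : rho T x y ≤ edist x y := by
  refine (rho_le_of_path (γ := fun t => AffineMap.lineMap x y t)
    AffineMap.lineMap_continuous (by simp) (by simp) h).trans ?_
  have hL : LipschitzWith (nndist x y) (fun t : ℝ => AffineMap.lineMap x y t) :=
    lipschitzWith_lineMap x y
  have h1 := (hL.lipschitzOnWith (s := Set.univ)).comp_eVariationOn_le
    (g := (id : ℝ → ℝ)) (s := Set.Icc 0 1) (fun _ _ => Set.mem_univ _)
  have h2 := (monotone_id.monotoneOn (Set.Icc (0 : ℝ) 1)).eVariationOn_eq (a := 0) (b := 1)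
    (by simp) (by simp)
  rw [Set.inter_self] at h2
  simpa [h2] using h1

theorem rho_comm_le (T : Set E3) (x y : E3) : rho T y x ≤ rho T x y := by
  conv_rhs => unfold rho
  refine le_iInf fun γ => le_iInf fun hc => le_iInf fun h0 => le_iInf fun h1 =>
    le_iInf fun hT => ?_
  refine (rho_le_of_path (γ := γ ∘ fun t => 1 - t) (by fun_prop) (by simpa) (by simpa)
    fun t ht => hT _ ⟨by linarith [ht.2], by linarith [ht.1]⟩).trans ?_
  refine eVariationOn.comp_le_of_antitoneOn γ _ (fun s _ t _ hst => sub_le_sub_left hst 1) ?_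
  exact fun t ht => ⟨by linarith [ht.2], by linarith [ht.1]⟩

theorem rho_triangle (T : Set E3) (x y z : E3) : rho T x z ≤ rho T x y + rho T y z := by
  have key : ∀ γ₁ γ₂ : ℝ → E3, Continuous γ₁ → Continuous γ₂ → γ₁ 0 = x → γ₁ 1 = y →
      γ₂ 0 = y → γ₂ 1 = z → (∀ t ∈ Set.Icc (0 : ℝ) 1, γ₁ t ∈ T) →
      (∀ t ∈ Set.Icc (0 : ℝ) 1, γ₂ t ∈ T) →
      rho T x z ≤ eVariationOn γ₁ (Set.Icc 0 1) + eVariationOn γ₂ (Set.Icc 0 1) := by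
    intro γ₁ γ₂ c₁ c₂ h₁0 h₁1 h₂0 h₂1 T₁ T₂
    let γ : ℝ → E3 := fun t => if t ≤ 1 / 2 then γ₁ (2 * t) else γ₂ (2 * t - 1)
    have hγc : Continuous γ := by
      refine Continuous.if_le (by fun_prop) (by fun_prop) (by fun_prop) (by fun_prop) ?_
      rintro t rfl
      norm_num [h₁1, h₂0]
    have e₁ : Set.EqOn γ (γ₁ ∘ fun t => 2 * t) (Set.Icc 0 (1 / 2)) := by
      intro t ht
      simp only [γ, Function.comp, if_pos ht.2]
    have e₂ : Set.EqOn γ (γ₂ ∘ fun t => 2 * t - 1) (Set.Icc (1 / 2) 1) := by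
      intro t ht
      rcases ht.1.eq_or_lt with h | h
      · subst h
        norm_num [γ, h₁1, h₂0]
      · simp only [γ, Function.comp, if_neg h.not_ge]
    have hle := rho_le_of_path (T := T) (x := x) (y := z) hγc (by norm_num [γ, h₁0])
      (by norm_num [γ, h₂1]) (by
        intro t ht
        by_cases h : t ≤ 1 / 2
        · simp only [γ, if_pos h]
          exact T₁ _ ⟨by linarith [ht.1], by linarith⟩
        · simp only [γ, if_neg h]
          exact T₂ _ ⟨by linarith, by linarith [ht.2]⟩)
    refine hle.trans ?_
    have hadd := eVariationOn.Icc_add_Icc γ (s := Set.univ) (a := 0) (b := 1 / 2) (c := 1)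
      (by norm_num) (by norm_num) (Set.mem_univ _)
    simp only [Set.univ_inter] at hadd
    rw [← hadd, eVariationOn.congr e₁, eVariationOn.congr e₂]
    refine add_le_add (eVariationOn.comp_le_of_monotoneOn _ _ ?_ ?_)
      (eVariationOn.comp_le_of_monotoneOn _ _ ?_ ?_)
    · intro s _ t _ h
      simpa using h
    · exact fun t ht => ⟨by linarith [ht.1], by linarith [ht.2]⟩
    · intro s _ t _ h
      simpa using h
    · exact fun t ht => ⟨by linarith [ht.1], by linarith [ht.2]⟩
  conv_rhs => unfold rho
  simp only [ENNReal.iInf_add, ENNReal.add_iInf]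
  exact le_iInf fun γ₂ => le_iInf fun c₂ => le_iInf fun p₂ => le_iInf fun q₂ =>
    le_iInf fun t₂ => le_iInf fun γ₁ => le_iInf fun c₁ => le_iInf fun p₁ => le_iInf fun q₁ =>
    le_iInf fun t₁ => key γ₁ γ₂ c₁ c₂ p₁ q₁ p₂ q₂ t₁ t₂

/-- The frontier of a simplex consists of the points with nonnegative barycentric coordinates,
one of which vanishes. -/
theorem mem_frontier_simplex_iff (B : AffineBasis (Fin 4) ℝ E3) (x : E3) :
    x ∈ frontier (convexHull ℝ (Set.range B)) ↔
      (∀ i, 0 ≤ B.coord i x) ∧ ∃ i, B.coord i x = 0 := by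
  have hcl : IsClosed (convexHull ℝ (Set.range B)) :=
    (Set.finite_range B).isClosed_convexHull (𝕜 := ℝ)
  rw [hcl.frontier_eq, Set.mem_sdiff, B.interior_convexHull, B.convexHull_eq_nonneg_coord]
  simp only [Set.mem_ofPred_eq, not_forall, not_lt]
  exact and_congr_right fun h => exists_congr fun i => ⟨fun hi => le_antisymm hi (h i), le_of_eq⟩

/-- Two points in a common face of a simplex are joined by a segment in its frontier. -/
theorem rho_le_edist_of_common_face (B : AffineBasis (Fin 4) ℝ E3) {x y : E3} (k : Fin 4)
    (hx : ∀ i, 0 ≤ B.coord i x) (hy : ∀ i, 0 ≤ B.coord i y)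
    (hxk : B.coord k x = 0) (hyk : B.coord k y = 0) :
    rho (frontier (convexHull ℝ (Set.range B))) x y ≤ edist x y := by
  refine rho_le_edist_of_segment fun t ht => ?_
  rw [mem_frontier_simplex_iff]
  have key : ∀ i, B.coord i (AffineMap.lineMap x y t)
      = (1 - t) * B.coord i x + t * B.coord i y := by
    intro i
    rw [AffineMap.apply_lineMap, AffineMap.lineMap_apply_ring]
  refine ⟨fun i => ?_, k, ?_⟩
  · rw [key]
    exact add_nonneg (mul_nonneg (by linarith [ht.2]) (hx i)) (mul_nonneg ht.1 (hy i))
  · rw [key, hxk, hyk]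
    simp

theorem coord_midpoint (B : AffineBasis (Fin 4) ℝ E3) (i : Fin 4) :
    B.coord i (midpoint ℝ (B 0) (B 1)) = (B.coord i (B 0) + B.coord i (B 1)) / 2 := by
  rw [AffineMap.map_midpoint, midpoint_eq_smul_add, smul_eq_mul, invOf_eq_inv]
  ring

theorem coord_midpoint_nonneg (B : AffineBasis (Fin 4) ℝ E3) (i : Fin 4) :
    0 ≤ B.coord i (midpoint ℝ (B 0) (B 1)) := by
  rw [coord_midpoint, B.coord_apply, B.coord_apply]
  split_ifs <;> norm_num

/-- In a face opposite to an endpoint of the edge, one reaches the midpoint of the edge through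
a point of the side joining the other endpoint `B i` to `B 2`. -/
theorem rho_midpoint_le_of_end_face (B : AffineBasis (Fin 4) ℝ E3) (i j : Fin 4)
    (hij : i ≠ j) (hj2 : j ≠ 2) (hi3 : i ≠ 3) {x : E3} (hx : ∀ k, 0 ≤ B.coord k x)
    (hxj : B.coord j x = 0) {L : ℝ}
    (hsum : B.coord i x + B.coord 2 x + B.coord 3 x = 1)
    (hcomb : x = B.coord i x • B i + B.coord 2 x • B 2 + B.coord 3 x • B 3)
    (hi : dist (B i) (midpoint ℝ (B 0) (B 1)) ≤ L / 2)
    (h2 : dist (B 2) (midpoint ℝ (B 0) (B 1)) ≤ L / 6)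
    (h3 : dist (B 3) (midpoint ℝ (B 0) (B 1)) ≤ L / 6) :
    rho (frontier (convexHull ℝ (Set.range B))) x (midpoint ℝ (B 0) (B 1))
      ≤ ENNReal.ofReal (L / 2) := by
  set m := midpoint ℝ (B 0) (B 1) with hm
  set u := B.coord i x with hu
  set v := B.coord 2 x with hv
  set w := B.coord 3 x with hw
  have hu0 : 0 ≤ u := hx i
  have hv0 : 0 ≤ v := hx 2
  have hw0 : 0 ≤ w := hx 3
  let p : E3 := AffineMap.lineMap (B 2) (B i) u
  have hp : ∀ k, B.coord k p = (1 - u) * B.coord k (B 2) + u * B.coord k (B i) := by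
    intro k
    rw [AffineMap.apply_lineMap, AffineMap.lineMap_apply_ring]
  have hp0 : ∀ k, 0 ≤ B.coord k p := by
    intro k
    rw [hp, B.coord_apply, B.coord_apply]
    refine add_nonneg (mul_nonneg (by linarith) ?_) (mul_nonneg hu0 ?_) <;> split_ifs <;> simp
  have hpj : B.coord j p = 0 := by
    rw [hp, B.coord_apply, B.coord_apply, if_neg hj2, if_neg hij.symm]
    simp
  have hp3 : B.coord 3 p = 0 := by
    rw [hp, B.coord_apply, B.coord_apply, if_neg (by decide), if_neg hi3.symm]
    simp
  have hm3 : B.coord 3 m = 0 := by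
    rw [hm, coord_midpoint, B.coord_apply, B.coord_apply, if_neg (by decide), if_neg (by decide)]
    simp
  have d1 : dist x p ≤ w * (L / 3) := by
    have hxp : x - p = w • (B 3 - B 2) := by
      have hv' : v = 1 - u - w := by linarith
      rw [show p = (1 - u) • B 2 + u • B i from AffineMap.lineMap_apply_module _ _ _]
      conv_lhs => rw [hcomb]
      rw [hv']
      module
    rw [dist_eq_norm, hxp, norm_smul, Real.norm_of_nonneg hw0, ← dist_eq_norm]
    refine mul_le_mul_of_nonneg_left ?_ hw0
    linarith [dist_triangle_right (B 3) (B 2) m]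
  have d2 : dist p m ≤ (1 - u) * (L / 6) + u * (L / 2) := by
    have hpm : p - m = (1 - u) • (B 2 - m) + u • (B i - m) := by
      rw [show p = (1 - u) • B 2 + u • B i from AffineMap.lineMap_apply_module _ _ _]
      module
    rw [dist_eq_norm, hpm]
    refine (norm_add_le _ _).trans ?_
    rw [norm_smul, norm_smul, Real.norm_of_nonneg hu0,
      Real.norm_of_nonneg (show 0 ≤ 1 - u by linarith), ← dist_eq_norm, ← dist_eq_norm]
    exact add_le_add (mul_le_mul_of_nonneg_left h2 (by linarith)) (mul_le_mul_of_nonneg_left hi hu0)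
  have hL : 0 ≤ L := by linarith [dist_nonneg (x := B i) (y := m)]
  calc rho _ x m ≤ rho _ x p + rho _ p m := rho_triangle _ _ _ _
    _ ≤ edist x p + edist p m := add_le_add
        (rho_le_edist_of_common_face B j hx hp0 hxj hpj)
        (rho_le_edist_of_common_face B 3 hp0 (coord_midpoint_nonneg B) hp3 hm3)
    _ = ENNReal.ofReal (dist x p + dist p m) := by
        rw [edist_dist, edist_dist, ENNReal.ofReal_add dist_nonneg dist_nonneg]
    _ ≤ _ := ENNReal.ofReal_le_ofReal (by nlinarith [mul_nonneg hv0 hL])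

/-- Every point of the surface is within half the length of the edge `[B 0, B 1]` from its midpoint,
for the intrinsic distance. -/
theorem rho_midpoint_le (B : AffineBasis (Fin 4) ℝ E3)
    (h2 : dist (B 2) (midpoint ℝ (B 0) (B 1)) ≤ dist (B 0) (B 1) / 6)
    (h3 : dist (B 3) (midpoint ℝ (B 0) (B 1)) ≤ dist (B 0) (B 1) / 6)
    {x : E3} (hx : x ∈ frontier (convexHull ℝ (Set.range B))) :
    rho (frontier (convexHull ℝ (Set.range B))) x (midpoint ℝ (B 0) (B 1))
      ≤ ENNReal.ofReal (dist (B 0) (B 1) / 2) := by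
  obtain ⟨hx0, k, hk⟩ := (mem_frontier_simplex_iff B x).1 hx
  have hsum := B.sum_coord_apply_eq_one x
  have hcomb := B.linear_combination_coord_eq_self x
  rw [Fin.sum_univ_four] at hsum hcomb
  have h0 : dist (B 0) (midpoint ℝ (B 0) (B 1)) ≤ dist (B 0) (B 1) / 2 := by
    rw [dist_left_midpoint, Real.norm_ofNat, inv_mul_eq_div]
  have h1 : dist (B 1) (midpoint ℝ (B 0) (B 1)) ≤ dist (B 0) (B 1) / 2 := by
    rw [dist_right_midpoint, Real.norm_ofNat, inv_mul_eq_div]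
  have hd : dist x (midpoint ℝ (B 0) (B 1)) ≤ dist (B 0) (B 1) / 2 := by
    have hsub : convexHull ℝ (Set.range B) ⊆
        Metric.closedBall (midpoint ℝ (B 0) (B 1)) (dist (B 0) (B 1) / 2) := by
      refine convexHull_min ?_ (convex_closedBall _ _)
      rintro _ ⟨i, rfl⟩
      have hD := dist_nonneg (x := B 0) (y := B 1)
      rw [Metric.mem_closedBall]
      fin_cases i
      exacts [h0, h1, h2.trans (by linarith), h3.trans (by linarith)]
    have hcl : IsClosed (convexHull ℝ (Set.range B)) :=
      (Set.finite_range B).isClosed_convexHull (𝕜 := ℝ)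
    exact Metric.mem_closedBall.1 (hsub (hcl.frontier_subset hx))
  have hside : ∀ j : Fin 4, j ≠ 0 → j ≠ 1 → B.coord j x = 0 →
      rho (frontier (convexHull ℝ (Set.range B))) x (midpoint ℝ (B 0) (B 1))
        ≤ ENNReal.ofReal (dist (B 0) (B 1) / 2) := by
    intro j hj0 hj1 hj
    refine (rho_le_edist_of_common_face B j hx0 (coord_midpoint_nonneg B) hj ?_).trans ?_
    · rw [coord_midpoint, B.coord_apply, B.coord_apply, if_neg hj0, if_neg hj1]
      simp
    · rw [edist_dist]
      exact ENNReal.ofReal_le_ofReal hd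
  fin_cases k
  · refine rho_midpoint_le_of_end_face B 1 0 (by decide) (by decide) (by decide) hx0 hk ?_ ?_
      h1 h2 h3
    · simp only [Fin.zero_eta] at hk
      linarith
    · simp only [Fin.zero_eta] at hk
      conv_lhs => rw [← hcomb, hk, zero_smul, zero_add]
  · refine rho_midpoint_le_of_end_face B 0 1 (by decide) (by decide) (by decide) hx0 hk ?_ ?_
      h0 h2 h3
    · simp only [Fin.mk_one] at hk
      linarith
    · simp only [Fin.mk_one] at hk
      conv_lhs => rw [← hcomb, hk, zero_smul, add_zero]
  · exact hside 2 (by decide) (by decide) hk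
  · exact hside 3 (by decide) (by decide) hk

theorem stmt16 :
    ∃ ε₀ : ℝ, 0 < ε₀ ∧
      ∀ a b c d : EuclideanSpace ℝ (Fin 3),
        AffineIndependent ℝ ![a, b, c, d] →
        c ∈ Metric.closedBall (midpoint ℝ a b) (ε₀ * dist a b) →
        d ∈ Metric.closedBall (midpoint ℝ a b) (ε₀ * dist a b) →
        ∀ T : Set (EuclideanSpace ℝ (Fin 3)),
          T = frontier (convexHull ℝ ({a, b, c, d} : Set (EuclideanSpace ℝ (Fin 3)))) →
          intrinsicDiam T = EMetric.diam T := by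
  refine ⟨1 / 6, by norm_num, ?_⟩
  intro a b c d hind hc hd T hT
  have htop : affineSpan ℝ (Set.range ![a, b, c, d]) = ⊤ := by
    rw [hind.affineSpan_eq_top_iff_card_eq_finrank_add_one]
    simp
  let B : AffineBasis (Fin 4) ℝ E3 := ⟨![a, b, c, d], hind, htop⟩
  have hrange : Set.range B = {a, b, c, d} := by
    change Set.range ![a, b, c, d] = _
    ext z
    simp only [Set.mem_range, Fin.exists_fin_succ, Set.mem_insert_iff, Set.mem_singleton_iff]
    simp [eq_comm]
  rw [← hrange] at hT
  have hc' : dist (B 2) (midpoint ℝ (B 0) (B 1)) ≤ dist (B 0) (B 1) / 6 :=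
    (Metric.mem_closedBall.1 hc).trans (le_of_eq (by change 1 / 6 * dist a b = dist a b / 6; ring))
  have hd' : dist (B 3) (midpoint ℝ (B 0) (B 1)) ≤ dist (B 0) (B 1) / 6 :=
    (Metric.mem_closedBall.1 hd).trans (le_of_eq (by change 1 / 6 * dist a b = dist a b / 6; ring))
  have hvert : ∀ i, B i ∈ T := by
    intro i
    rw [hT, mem_frontier_simplex_iff]
    refine ⟨fun j => ?_, i + 1, ?_⟩
    · rw [B.coord_apply]
      split_ifs <;> simp
    · rw [B.coord_apply, if_neg (by simp)]
  apply le_antisymm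
  · refine iSup₂_le fun x hx => iSup₂_le fun y hy => ?_
    have hxm := rho_midpoint_le B hc' hd' (hT ▸ hx)
    have hym := rho_midpoint_le B hc' hd' (hT ▸ hy)
    rw [← hT] at hxm hym
    calc rho T x y ≤ rho T x (midpoint ℝ (B 0) (B 1)) + rho T (midpoint ℝ (B 0) (B 1)) y :=
          rho_triangle _ _ _ _
      _ ≤ ENNReal.ofReal (dist (B 0) (B 1) / 2) + ENNReal.ofReal (dist (B 0) (B 1) / 2) :=
          add_le_add hxm ((rho_comm_le _ _ _).trans hym)
      _ = edist (B 0) (B 1) := by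
          rw [← ENNReal.ofReal_add (by positivity) (by positivity), add_halves, edist_dist]
      _ ≤ _ := Metric.edist_le_ediam_of_mem (hvert 0) (hvert 1)
  · refine Metric.ediam_le fun x hx y hy => (edist_le_rho T x y).trans ?_
    exact le_iSup₂_of_le x hx (le_iSup₂_of_le y hy le_rfl)
end
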